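/- arXiv:1606.04742 — 5 statements merged into one kernel-verified Lean document; each statement's English description precedes it below -/
import Mathlib

section
/- Let D ⊆ ℝ^m be a closed convex set with nonempty interior, let y be a point of the boundary ∂D of D, and let n ∈ ℝ^m be a unit vector which is an inward normal at y, i.e. ⟨y − x, n⟩ ≤ 0 for every x ∈ D. Then for every a in the interior of D one has ⟨y − a, n⟩ ≤ −dist(a, ∂D). -/
open scoped RealInnerProductSpace

/-- If `D ⊆ ℝ^m` is a closed convex set with nonempty interior, `y` is a boundary point
of `D`, and `n` is a unit inward normal vector at `y` (i.e. `⟪y - x, n⟫ ≤ 0` for all `x ∈ D`),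
then for every `a` in the interior of `D` one has `⟪y - a, n⟫ ≤ -dist(a, ∂D)`. -/
theorem inward_normal_interior_estimate {m : ℕ}
    (D : Set (EuclideanSpace ℝ (Fin m)))
    (hDclosed : IsClosed D) (hDconv : Convex ℝ D) (hDint : (interior D).Nonempty)
    (y : EuclideanSpace ℝ (Fin m)) (hy : y ∈ frontier D)
    (n : EuclideanSpace ℝ (Fin m)) (hn : ‖n‖ = 1)
    (hnormal : ∀ x ∈ D, ⟪y - x, n⟫ ≤ 0) :
    ∀ a ∈ interior D, ⟪y - a, n⟫ ≤ -Metric.infDist a (frontier D) := by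
  intro a ha
  by_contra hcon
  push Not at hcon
  have haD : a ∈ D := interior_subset ha
  have h0 := hnormal a haD
  obtain ⟨s, hs1, hs2⟩ :=
    exists_between (show -⟪y - a, n⟫ < Metric.infDist a (frontier D) by linarith)
  have hs0 : 0 ≤ s := by linarith
  have hx : a - s • n ∉ D := by
    intro hxD
    have h1 := hnormal _ hxD
    have h2 : y - (a - s • n) = (y - a) + s • n := by abel
    rw [h2, inner_add_left, real_inner_smul_left, real_inner_self_eq_norm_sq, hn] at h1
    linarith
  have hpre : IsPreconnected (Metric.closedBall a s) :=
    (convex_closedBall a s).isPreconnected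
  obtain ⟨z, hz, hzf⟩ : (Metric.closedBall a s ∩ frontier D).Nonempty := by
    by_contra hne
    obtain ⟨w, -, hw1, hw2⟩ := hpre (interior D) Dᶜ isOpen_interior hDclosed.isOpen_compl
      (by
        intro w hw
        by_cases hwD : w ∈ D
        · left
          by_contra hwi
          exact hne ⟨w, hw, subset_closure hwD, hwi⟩
        · exact Or.inr hwD)
      ⟨a, Metric.mem_closedBall_self hs0, ha⟩
      ⟨a - s • n, by
        simp [Metric.mem_closedBall, dist_eq_norm, norm_smul, hn, abs_of_nonneg hs0], hx⟩
    exact hw2 (interior_subset hw1)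
  have h3 := Metric.infDist_le_dist_of_mem (x := a) hzf
  rw [Metric.mem_closedBall, dist_comm] at hz
  linarith
end

section
/- For any nonempty bounded closed convex sets D, G ⊆ ℝ^m and any points x, y ∈ ℝ^m, the metric projections satisfy ‖Π_D(x) − Π_G(y)‖² ≤ ‖x − y‖² + 2·(dist(x,D) + dist(y,G))·ρ(D,G), where ρ(D,G) is the Hausdorff distance between D and G. -/
theorem proj_aux {m : ℕ} (D G : Set (EuclideanSpace ℝ (Fin m)))
    (hDbdd : Bornology.IsBounded D) (hDclosed : IsClosed D) (hDconv : Convex ℝ D)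
    (hGbdd : Bornology.IsBounded G) (x p q : EuclideanSpace ℝ (Fin m)) (hpD : p ∈ D)
    (hp : ‖p - x‖ = Metric.infDist x D) (hqG : q ∈ G) :
    inner ℝ (x - p) (q - p) ≤ Metric.infDist x D * Metric.hausdorffDist D G := by
  have hDne : D.Nonempty := ⟨p, hpD⟩
  have hGne : G.Nonempty := ⟨q, hqG⟩
  obtain ⟨z, hzD, hz⟩ := hDclosed.exists_infDist_eq_dist hDne q
  have h1 : Metric.infDist q D ≤ Metric.hausdorffDist D G := by
    rw [Metric.hausdorffDist_comm]
    exact Metric.infDist_le_hausdorffDist_of_mem hqG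
      (Metric.hausdorffEDist_ne_top_of_nonempty_of_bounded hGne hDne hGbdd hDbdd)
  have h2 : inner ℝ (x - p) (z - p) ≤ 0 := by
    refine (norm_eq_iInf_iff_real_inner_le_zero hDconv hpD).1 ?_ z hzD
    rw [norm_sub_rev, hp, Metric.infDist_eq_iInf]
    simp only [dist_eq_norm]
  have h3 : inner ℝ (x - p) (q - z) ≤ ‖x - p‖ * ‖q - z‖ := real_inner_le_norm _ _
  have h4 : q - p = (q - z) + (z - p) := by abel
  rw [h4, inner_add_right]
  rw [hz, dist_eq_norm] at h1
  have h5 : ‖x - p‖ * ‖q - z‖ ≤ ‖x - p‖ * Metric.hausdorffDist D G :=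
    mul_le_mul_of_nonneg_left h1 (norm_nonneg _)
  rw [← hp, norm_sub_rev p x]
  linarith

/-- For nonempty bounded closed convex sets `D, G ⊆ ℝ^m` and points `x, y ∈ ℝ^m`, the
metric projections `p = Π_D(x)` and `q = Π_G(y)` (characterized by `p ∈ D`,
`‖p - x‖ = dist(x, D)`, `q ∈ G`, `‖q - y‖ = dist(y, G)`) satisfy
`‖p - q‖² ≤ ‖x - y‖² + 2 (dist(x, D) + dist(y, G)) ρ(D, G)`,
where `ρ` is the Hausdorff distance. -/
theorem proj_hausdorff_estimate {m : ℕ}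
    (D G : Set (EuclideanSpace ℝ (Fin m)))
    (hDne : D.Nonempty) (hDbdd : Bornology.IsBounded D)
    (hDclosed : IsClosed D) (hDconv : Convex ℝ D)
    (hGne : G.Nonempty) (hGbdd : Bornology.IsBounded G)
    (hGclosed : IsClosed G) (hGconv : Convex ℝ G)
    (x y : EuclideanSpace ℝ (Fin m))
    (p : EuclideanSpace ℝ (Fin m)) (hpD : p ∈ D)
    (hp : ‖p - x‖ = Metric.infDist x D)
    (q : EuclideanSpace ℝ (Fin m)) (hqG : q ∈ G)
    (hq : ‖q - y‖ = Metric.infDist y G) :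
    ‖p - q‖ ^ 2 ≤ ‖x - y‖ ^ 2
      + 2 * (Metric.infDist x D + Metric.infDist y G) * Metric.hausdorffDist D G := by
  have h1 := proj_aux D G hDbdd hDclosed hDconv hGbdd x p q hpD hp hqG
  have h2 := proj_aux G D hGbdd hGclosed hGconv hDbdd y q p hqG hq hpD
  rw [Metric.hausdorffDist_comm] at h2
  have h3 : inner ℝ (x - p) (q - p) + inner ℝ (y - q) (p - q)
      = ‖p - q‖ ^ 2 - inner ℝ (x - y) (p - q) := by
    rw [← real_inner_self_eq_norm_sq, ← neg_sub p q, inner_neg_right]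
    simp only [inner_sub_left]
    ring
  have h4 := real_inner_le_norm (x - y) (p - q)
  nlinarith [sq_nonneg (‖x - y‖ - ‖p - q‖)]
end

section
/- Let X be a metric space and let D : X → Conv be a map, continuous with respect to the Hausdorff distance ρ, where Conv denotes the collection of nonempty bounded closed convex subsets of ℝ^m. Then the map X × ℝ^m ∋ (t, y) ↦ Π_{D(t)}(y) ∈ ℝ^m is continuous. -/
open scoped Classical

/-- The metric projection onto a set `D ⊆ ℝ^m`: the (unique, when `D` is nonempty,
closed and convex) point `y ∈ D` with `‖y - x‖ = dist(x, D)`. -/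
noncomputable def metricProj {m : ℕ} (D : Set (EuclideanSpace ℝ (Fin m)))
    (x : EuclideanSpace ℝ (Fin m)) : EuclideanSpace ℝ (Fin m) :=
  if h : ∃ y, y ∈ D ∧ ‖y - x‖ = Metric.infDist x D then h.choose else x

theorem metricProj_spec {m : ℕ} (K : TopologicalSpace.NonemptyCompacts (EuclideanSpace ℝ (Fin m)))
    (x : EuclideanSpace ℝ (Fin m)) :
    metricProj (K : Set (EuclideanSpace ℝ (Fin m))) x ∈ (K : Set (EuclideanSpace ℝ (Fin m))) ∧
    ‖metricProj (K : Set (EuclideanSpace ℝ (Fin m))) x - x‖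
      = Metric.infDist x (K : Set (EuclideanSpace ℝ (Fin m))) := by
  have h : ∃ y, y ∈ (K : Set (EuclideanSpace ℝ (Fin m))) ∧
      ‖y - x‖ = Metric.infDist x (K : Set (EuclideanSpace ℝ (Fin m))) := by
    obtain ⟨y, hy, e⟩ := K.isCompact.exists_infDist_eq_dist K.nonempty x
    exact ⟨y, hy, by rw [e, dist_comm, dist_eq_norm]⟩
  unfold metricProj
  rw [dif_pos h]
  exact h.choose_spec

theorem metricProj_inner {m : ℕ} (K : TopologicalSpace.NonemptyCompacts (EuclideanSpace ℝ (Fin m)))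
    (hK : Convex ℝ (K : Set (EuclideanSpace ℝ (Fin m))))
    (x w : EuclideanSpace ℝ (Fin m)) (hw : w ∈ (K : Set (EuclideanSpace ℝ (Fin m)))) :
    inner ℝ (x - metricProj (K : Set (EuclideanSpace ℝ (Fin m))) x)
      (w - metricProj (K : Set (EuclideanSpace ℝ (Fin m))) x) ≤ 0 := by
  obtain ⟨h1, h2⟩ := metricProj_spec K x
  refine (norm_eq_iInf_iff_real_inner_le_zero hK h1).1 ?_ w hw
  rw [norm_sub_rev, h2, Metric.infDist_eq_iInf]
  simp only [dist_eq_norm]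

theorem metricProj_inner_near {m : ℕ}
    (K L : TopologicalSpace.NonemptyCompacts (EuclideanSpace ℝ (Fin m)))
    (hK : Convex ℝ (K : Set (EuclideanSpace ℝ (Fin m))))
    (x b : EuclideanSpace ℝ (Fin m)) (hb : b ∈ (L : Set (EuclideanSpace ℝ (Fin m)))) :
    inner ℝ (x - metricProj (K : Set (EuclideanSpace ℝ (Fin m))) x)
      (b - metricProj (K : Set (EuclideanSpace ℝ (Fin m))) x)
      ≤ ‖x - metricProj (K : Set (EuclideanSpace ℝ (Fin m))) x‖ * dist L K := by
  obtain ⟨w, hw, e⟩ := K.isCompact.exists_infDist_eq_dist K.nonempty b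
  have h1 : dist b w ≤ dist L K := by
    rw [← e, Metric.NonemptyCompacts.dist_eq]
    exact Metric.infDist_le_hausdorffDist_of_mem hb
      (Metric.hausdorffEDist_ne_top_of_nonempty_of_bounded L.nonempty K.nonempty
        L.isCompact.isBounded K.isCompact.isBounded)
  have h2 := metricProj_inner K hK x w hw
  set a := metricProj (K : Set (EuclideanSpace ℝ (Fin m))) x
  have h3 : b - a = (w - a) + (b - w) := by abel
  rw [h3, inner_add_right]
  have h4 := real_inner_le_norm (x - a) (b - w)
  rw [dist_eq_norm] at h1
  have h5 := mul_le_mul_of_nonneg_left h1 (norm_nonneg (x - a))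
  linarith

theorem metricProj_dist_le {m : ℕ}
    (K L : TopologicalSpace.NonemptyCompacts (EuclideanSpace ℝ (Fin m)))
    (hK : Convex ℝ (K : Set (EuclideanSpace ℝ (Fin m))))
    (hL : Convex ℝ (L : Set (EuclideanSpace ℝ (Fin m))))
    (x y : EuclideanSpace ℝ (Fin m)) :
    dist (metricProj (L : Set (EuclideanSpace ℝ (Fin m))) y)
      (metricProj (K : Set (EuclideanSpace ℝ (Fin m))) x)
      ≤ dist y x + dist L K + Real.sqrt (dist L K *
        (2 * ‖x - metricProj (K : Set (EuclideanSpace ℝ (Fin m))) x‖ + dist y x)) := by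
  have h1 := metricProj_inner_near K L hK x _ (metricProj_spec L y).1
  have h2 := metricProj_inner_near L K hL y _ (metricProj_spec K x).1
  rw [dist_comm K L] at h2
  set a := metricProj (K : Set (EuclideanSpace ℝ (Fin m))) x
  set b := metricProj (L : Set (EuclideanSpace ℝ (Fin m))) y
  have hh : 0 ≤ dist L K := dist_nonneg
  set h := dist L K
  rw [dist_eq_norm, dist_eq_norm]
  have h3 : ‖b - a‖ ^ 2 = inner ℝ (y - x) (b - a) + inner ℝ (x - a) (b - a)
      + inner ℝ (y - b) (a - b) := by
    rw [← real_inner_self_eq_norm_sq, ← neg_sub b a, inner_neg_right, ← sub_eq_add_neg,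
      ← inner_add_left, ← inner_sub_left]
    congr 1
    abel
  have h4 := real_inner_le_norm (y - x) (b - a)
  have h5 : ‖y - b‖ ≤ ‖y - x‖ + ‖x - a‖ + ‖b - a‖ := by
    have e : y - b = (y - x) + (x - a) - (b - a) := by abel
    rw [e]
    exact (norm_sub_le _ _).trans (by gcongr; exact norm_add_le _ _)
  have h6 := mul_le_mul_of_nonneg_right h5 hh
  have he := norm_nonneg (y - x)
  have hR := norm_nonneg (x - a)
  have hd := norm_nonneg (b - a)
  generalize ‖y - x‖ = e at *
  generalize ‖x - a‖ = R at *
  generalize ‖b - a‖ = d at *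
  have hp : 0 ≤ h * (2 * R + e) := by positivity
  have hs := Real.sq_sqrt hp
  have hs0 := Real.sqrt_nonneg (h * (2 * R + e))
  generalize Real.sqrt (h * (2 * R + e)) = s at *
  have h7 : d ^ 2 ≤ (e + h) * d + s ^ 2 := by nlinarith
  by_contra hc
  push Not at hc
  nlinarith [mul_nonneg (add_nonneg he hh) hs0]

/-- If `X` is a metric space and `D : X → Conv` is continuous with respect to the Hausdorff
distance (here `Conv`, the nonempty bounded closed convex subsets of `ℝ^m`, is encoded as the
nonempty compact subsets that are convex, with the Hausdorff metric), then the map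
`(t, y) ↦ Π_{D(t)}(y)` is continuous on `X × ℝ^m`. -/
theorem continuous_metricProj_of_continuous_obstacle {m : ℕ} {X : Type*} [MetricSpace X]
    (D : X → TopologicalSpace.NonemptyCompacts (EuclideanSpace ℝ (Fin m)))
    (hconv : ∀ t, Convex ℝ (D t : Set (EuclideanSpace ℝ (Fin m))))
    (hD : Continuous D) :
    Continuous fun p : X × EuclideanSpace ℝ (Fin m) =>
      metricProj (D p.1 : Set (EuclideanSpace ℝ (Fin m))) p.2 := by
  rw [continuous_iff_continuousAt]
  rintro ⟨t, x⟩
  rw [ContinuousAt, tendsto_iff_dist_tendsto_zero]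
  refine squeeze_zero (fun _ => dist_nonneg)
    (fun p => metricProj_dist_le (D t) (D p.1) (hconv t) (hconv p.1) x p.2) ?_
  refine Continuous.tendsto' (by fun_prop) _ _ ?_
  simp
end

section
/- Let D ⊆ ℝ^m be a closed convex set with nonempty interior, let ε ≥ 0, and let a ∈ D satisfy dist(a, ∂D) ≥ ε. Then for every y ∈ ℝ^m one has ⟨y − a, y − Π_D(y)⟩ ≥ ‖y − Π_D(y)‖² + ε·‖y − Π_D(y)‖. In particular ⟨y − a, y − Π_D(y)⟩ ≥ ε·‖y − Π_D(y)‖ ≥ 0. -/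
open scoped RealInnerProductSpace

/-- Let `D ⊆ ℝ^m` be a closed convex set with nonempty interior, `ε ≥ 0`, and let `a ∈ D`
satisfy `dist(a, ∂D) ≥ ε`. If `p = Π_D(y)` is the metric projection of `y` onto `D`
(i.e. `p ∈ D` and `‖p - y‖ = dist(y, D)`), then
`⟪y - a, y - p⟫ ≥ ‖y - p‖² + ε ‖y - p‖`; in particular
`⟪y - a, y - p⟫ ≥ ε ‖y - p‖ ≥ 0`. -/
theorem penalization_inner_lower_bound {m : ℕ}
    (D : Set (EuclideanSpace ℝ (Fin m)))
    (hDclosed : IsClosed D) (hDconv : Convex ℝ D) (hDint : (interior D).Nonempty)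
    (ε : ℝ) (hε : 0 ≤ ε)
    (a : EuclideanSpace ℝ (Fin m)) (haD : a ∈ D)
    (ha : ε ≤ Metric.infDist a (frontier D))
    (y p : EuclideanSpace ℝ (Fin m)) (hpD : p ∈ D)
    (hp : ‖p - y‖ = Metric.infDist y D) :
    ‖y - p‖ ^ 2 + ε * ‖y - p‖ ≤ ⟪y - a, y - p⟫ ∧
    ε * ‖y - p‖ ≤ ⟪y - a, y - p⟫ ∧
    0 ≤ ε * ‖y - p‖ := by
  have hball : Metric.closedBall a ε ⊆ D := by
    rcases hε.eq_or_lt with h0 | hpos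
    · rw [← h0, Metric.closedBall_zero]
      exact Set.singleton_subset_iff.mpr haD
    · rw [← closure_ball a hpos.ne']
      refine closure_minimal ?_ hDclosed
      intro w hw
      by_contra hwD
      have hpre : IsPreconnected (Metric.ball a ε) := (convex_ball a ε).isPreconnected
      have hint : ∀ z ∈ Metric.ball a ε, z ∈ D → z ∈ interior D := by
        intro z hz hzD
        by_contra hzi
        have hzf : z ∈ frontier D := ⟨subset_closure hzD, hzi⟩
        have h1 := Metric.infDist_le_dist_of_mem (x := a) hzf
        rw [Metric.mem_ball, dist_comm] at hz
        linarith
      have haB : a ∈ Metric.ball a ε := Metric.mem_ball_self hpos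
      obtain ⟨z, -, hz1, hz2⟩ := hpre (interior D) Dᶜ isOpen_interior hDclosed.isOpen_compl
        (fun z hz => (Classical.em (z ∈ D)).imp (hint z hz) id)
        ⟨a, haB, hint a haB haD⟩ ⟨w, hw, hwD⟩
      exact hz2 (interior_subset hz1)
  have hvar : ∀ w ∈ D, ⟪y - p, w - p⟫ ≤ 0 := by
    rw [← norm_eq_iInf_iff_real_inner_le_zero hDconv hpD, norm_sub_rev, hp,
      Metric.infDist_eq_iInf]
    simp only [dist_eq_norm]
  have hnn : 0 ≤ ε * ‖y - p‖ := mul_nonneg hε (norm_nonneg _)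
  have key : ⟪y - p, a - p⟫ + ε * ‖y - p‖ ≤ 0 := by
    by_cases h : ‖y - p‖ = 0
    · have := hvar a haD
      rw [h]; linarith
    · have hw : a + (ε / ‖y - p‖) • (y - p) ∈ D := by
        apply hball
        rw [Metric.mem_closedBall, dist_eq_norm, add_sub_cancel_left, norm_smul,
          Real.norm_of_nonneg (div_nonneg hε (norm_nonneg _)), div_mul_cancel₀ _ h]
      have h2 := hvar _ hw
      rw [add_sub_right_comm, inner_add_right, inner_smul_right,
        real_inner_self_eq_norm_sq] at h2
      have h3 : ε / ‖y - p‖ * ‖y - p‖ ^ 2 = ε * ‖y - p‖ := by field_simp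
      linarith
  have hsplit : ⟪y - a, y - p⟫ = ‖y - p‖ ^ 2 - ⟪y - p, a - p⟫ := by
    have : y - a = (y - p) - (a - p) := by abel
    rw [this, inner_sub_left, real_inner_self_eq_norm_sq, real_inner_comm]
  have hsq := sq_nonneg ‖y - p‖
  exact ⟨by linarith, by linarith, hnn⟩
end

section
/- Let D : [0,T] → Conv be continuous with respect to the Hausdorff distance ρ, where Conv denotes the collection of nonempty bounded closed convex subsets of ℝ^m. Let Y : [0,T] → ℝ^m be a bounded Borel function with Y(t) ∈ D(t) for every t, and let κ = (κ^1,…,κ^m) be an m-tuple of finite signed Borel measures on [0,T] satisfying the minimality condition: for every continuous h : [0,T] → ℝ^m with h(t) ∈ D(t) for all t ∈ [0,T], one has Σ_{i=1}^m ∫_0^T (Y^i(t) − h^i(t)) dκ^i(t) ≤ 0. Suppose u_* : [0,T] → ℝ^m is continuous, ε > 0, and the closed ball of radius ε centered at u_*(t) is contained in D(t) for every t ∈ [0,T]. Then Σ_{i=1}^m ∫_0^T (Y^i(t) − u_*^i(t)) dκ^i(t) ≤ −ε·‖κ‖([0,T]), where ‖κ‖ denotes the total variation measure of the ℝ^m-valued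 measure κ. -/
open scoped RealInnerProductSpace
open MeasureTheory

/-- Radial truncation onto the unit ball. -/
noncomputable def radTrunc {E : Type*} [NormedAddCommGroup E] [NormedSpace ℝ E] (x : E) : E :=
  (max 1 ‖x‖)⁻¹ • x

theorem radTrunc_continuous {E : Type*} [NormedAddCommGroup E] [NormedSpace ℝ E] :
    Continuous (radTrunc : E → E) := by
  unfold radTrunc
  refine Continuous.smul (Continuous.inv₀ (by fun_prop) ?_) continuous_id
  intro x
  have : (1 : ℝ) ≤ max 1 ‖x‖ := le_max_left _ _
  linarith

theorem radTrunc_norm_le {E : Type*} [NormedAddCommGroup E] [NormedSpace ℝ E] (x : E) :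
    ‖radTrunc x‖ ≤ 1 := by
  have h1 : (1 : ℝ) ≤ max 1 ‖x‖ := le_max_left _ _
  have h0 : (0 : ℝ) < max 1 ‖x‖ := by linarith
  unfold radTrunc
  rw [norm_smul, norm_inv, Real.norm_of_nonneg h0.le, inv_mul_le_iff₀ h0, mul_one]
  exact le_max_right _ _

theorem radTrunc_sub_le {E : Type*} [NormedAddCommGroup E] [NormedSpace ℝ E] (x g : E)
    (hg : ‖g‖ = 1) : ‖x - radTrunc x‖ ≤ ‖g - x‖ := by
  unfold radTrunc
  rcases le_total ‖x‖ 1 with h | h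
  · simp [max_eq_left h]
  · have h0 : 0 < ‖x‖ := by linarith
    have e : x - (max 1 ‖x‖)⁻¹ • x = (1 - ‖x‖⁻¹) • x := by
      rw [max_eq_right h, sub_smul, one_smul]
    have hi : ‖x‖⁻¹ ≤ 1 := inv_le_one_of_one_le₀ h
    rw [e, norm_smul, Real.norm_of_nonneg (by linarith), sub_mul, inv_mul_cancel₀ h0.ne', one_mul]
    have := norm_sub_norm_le x g
    rw [norm_sub_rev, hg] at this
    exact this

theorem radTrunc_inner {E : Type*} [NormedAddCommGroup E] [InnerProductSpace ℝ E] (x g : E)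
    (hg : ‖g‖ = 1) : 1 - 2 * ‖g - x‖ ≤ ⟪radTrunc x, g⟫ := by
  have h1 : ⟪g - radTrunc x, g⟫ ≤ ‖g - radTrunc x‖ * ‖g‖ := real_inner_le_norm _ _
  have h2 : ‖g - radTrunc x‖ ≤ ‖g - x‖ + ‖x - radTrunc x‖ := norm_sub_le_norm_sub_add_norm_sub _ _ _
  have h3 := radTrunc_sub_le x g hg
  rw [inner_sub_left, real_inner_self_eq_norm_sq, hg] at h1
  linarith

/-- Total variation bound on the obstacle reaction measure. Here the `ℝ^m`-valued measure
`κ = (κ^1,…,κ^m)` on `[0,T]` is encoded through its polar decomposition `κ = g · ν`, where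
`ν = ‖κ‖` is a finite (positive) Borel measure (the total variation measure of `κ`) and
`g : ℝ → ℝ^m` is a Borel density with `‖g(t)‖ = 1` for `ν`-a.e. `t ∈ [0,T]`; then
`Σ_i ∫_0^T w^i dκ^i = ∫_0^T ⟪w(t), g(t)⟫ dν(t)` and `‖κ‖([0,T]) = ν([0,T])`.

Let `D : [0,T] → Conv` be continuous for the Hausdorff distance (`D(t)` nonempty bounded
closed convex), let `Y` be a bounded Borel function with `Y(t) ∈ D(t)` on `[0,T]`, and
suppose the minimality condition holds: for every continuous `h : [0,T] → ℝ^m` with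
`h(t) ∈ D(t)` one has `Σ_i ∫_0^T (Y^i - h^i) dκ^i ≤ 0`. If `u_* : [0,T] → ℝ^m` is
continuous, `ε > 0`, and the closed ball of radius `ε` around `u_*(t)` is contained in
`D(t)` for all `t ∈ [0,T]`, then
`Σ_i ∫_0^T (Y^i - u_*^i) dκ^i ≤ -ε · ‖κ‖([0,T])`. -/
theorem reaction_measure_total_variation_bound {m : ℕ}
    (T : ℝ) (hT : 0 ≤ T)
    (D : ℝ → Set (EuclideanSpace ℝ (Fin m)))
    (hDne : ∀ t ∈ Set.Icc 0 T, (D t).Nonempty)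
    (hDbdd : ∀ t ∈ Set.Icc 0 T, Bornology.IsBounded (D t))
    (hDclosed : ∀ t ∈ Set.Icc 0 T, IsClosed (D t))
    (hDconv : ∀ t ∈ Set.Icc 0 T, Convex ℝ (D t))
    (hDcont : ∀ t₀ ∈ Set.Icc 0 T, ∀ η > (0 : ℝ), ∃ δ > (0 : ℝ), ∀ t ∈ Set.Icc 0 T,
      |t - t₀| < δ → Metric.hausdorffDist (D t) (D t₀) < η)
    (Y : ℝ → EuclideanSpace ℝ (Fin m)) (hYmeas : Measurable Y)
    (hYbdd : ∃ C : ℝ, ∀ t, ‖Y t‖ ≤ C)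
    (hYD : ∀ t ∈ Set.Icc 0 T, Y t ∈ D t)
    (ν : Measure ℝ) [IsFiniteMeasure ν]
    (g : ℝ → EuclideanSpace ℝ (Fin m)) (hgmeas : Measurable g)
    (hg1 : ∀ᵐ t ∂(ν.restrict (Set.Icc 0 T)), ‖g t‖ = 1)
    (hmin : ∀ h : ℝ → EuclideanSpace ℝ (Fin m), ContinuousOn h (Set.Icc 0 T) →
      (∀ t ∈ Set.Icc 0 T, h t ∈ D t) →
      ∫ t in Set.Icc 0 T, ⟪Y t - h t, g t⟫ ∂ν ≤ 0)
    (u : ℝ → EuclideanSpace ℝ (Fin m)) (hu : ContinuousOn u (Set.Icc 0 T))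
    (ε : ℝ) (hε : 0 < ε)
    (huD : ∀ t ∈ Set.Icc 0 T, Metric.closedBall (u t) ε ⊆ D t) :
    ∫ t in Set.Icc 0 T, ⟪Y t - u t, g t⟫ ∂ν ≤ -ε * (ν (Set.Icc 0 T)).toReal := by
  obtain ⟨C, hC⟩ := hYbdd
  set μ := ν.restrict (Set.Icc 0 T) with hμ
  have hgi : Integrable g μ :=
    Integrable.of_bound hgmeas.aestronglyMeasurable 1 (hg1.mono fun t ht => ht.le)
  have hYi : Integrable Y μ :=
    Integrable.of_bound hYmeas.aestronglyMeasurable C (Filter.Eventually.of_forall hC)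
  have key : ∀ w : ℝ → EuclideanSpace ℝ (Fin m), Integrable w μ →
      Integrable (fun t => ⟪w t, g t⟫) μ := by
    intro w hw
    refine hw.norm.mono' (hw.aestronglyMeasurable.inner hgi.aestronglyMeasurable) ?_
    filter_upwards [hg1] with t ht
    have := norm_inner_le_norm (𝕜 := ℝ) (w t) (g t)
    rwa [ht, mul_one] at this
  have hui : Integrable u μ := hu.integrableOn_Icc
  have huY := key _ (hYi.sub hui)
  refine le_of_forall_pos_le_add fun δ hδ => ?_
  obtain ⟨f, hf, hfi⟩ := hgi.exists_boundedContinuous_integral_sub_le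
    (ε := δ / (2 * ε)) (by positivity)
  have hhc : ContinuousOn (fun t => u t - ε • radTrunc (f t)) (Set.Icc 0 T) :=
    hu.sub (((radTrunc_continuous.comp f.continuous).const_smul ε).continuousOn)
  have hh := hmin (fun t => u t - ε • radTrunc (f t)) hhc (by
    intro t ht
    apply huD t ht
    rw [mem_closedBall_iff_norm]
    have := radTrunc_norm_le (f t)
    simp only [sub_sub_cancel_left, norm_neg, norm_smul, Real.norm_of_nonneg hε.le]
    nlinarith)
  have hhi : Integrable (fun t => ⟪Y t - (u t - ε • radTrunc (f t)), g t⟫) μ :=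
    key _ (hYi.sub hhc.integrableOn_Icc)
  have hn : Integrable (fun t => (2 * ε) * ‖g t - f t‖) μ := ((hgi.sub hfi).norm).const_mul _
  have hcst : Integrable (fun _ : ℝ => ε) μ := integrable_const _
  have hnc : Integrable (fun t => (2 * ε) * ‖g t - f t‖ - ε) μ := hn.sub hcst
  have hle : ∫ t, ⟪Y t - u t, g t⟫ ∂μ ≤
      ∫ t, (⟪Y t - (u t - ε • radTrunc (f t)), g t⟫ + ((2 * ε) * ‖g t - f t‖ - ε)) ∂μ := by
    refine integral_mono_ae huY (hhi.add (hn.sub hcst)) ?_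
    filter_upwards [hg1] with t ht
    have h1 := radTrunc_inner (f t) (g t) ht
    have e : Y t - (u t - ε • radTrunc (f t)) = (Y t - u t) + ε • radTrunc (f t) := by abel
    simp only [e, inner_add_left, real_inner_smul_left]
    nlinarith
  rw [integral_add hhi hnc, integral_sub hn hcst, integral_const_mul, integral_const] at hle
  have hm : μ.real Set.univ = (ν (Set.Icc 0 T)).toReal := by
    simp [hμ, Measure.real]
  rw [hm, smul_eq_mul] at hle
  have hf' : (2 * ε) * ∫ t, ‖g t - f t‖ ∂μ ≤ δ := by
    rw [le_div_iff₀ (by positivity)] at hf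
    linarith
  linarith
end
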